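/- Let L be the Laplacian of a strongly connected weighted digraph on N nodes. Then for x ∈ ℝ^N one has L·x = 0 if and only if x is a scalar multiple of the all-ones vector 𝟏_N; that is, the kernel (null space) of L is exactly the span of 𝟏_N. -/

import Mathlib

open Matrix

/-- A Laplacian acts on a vector by weighted differences. -/
lemma laplacian_mulVec_apply {ι : Type*} [Fintype ι] [DecidableEq ι] {a : ι → ι → ℝ}
    (ha_diag : ∀ i, a i i = 0) {L : Matrix ι ι ℝ}
    (hL : ∀ i j, L i j = if i = j then ∑ k, a i k else -(a i j)) (x : ι → ℝ) (i : ι) :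
    L.mulVec x i = ∑ j, a i j * (x i - x j) := by
  have hterm : ∀ j, L i j * x j = (if i = j then (∑ k, a i k) * x j else 0) - a i j * x j := by
    intro j
    rw [hL]
    split_ifs with hij
    · subst hij
      simp [ha_diag]
    · ring
  simp only [Matrix.mulVec, dotProduct, hterm, mul_sub, Finset.sum_sub_distrib,
    Finset.sum_ite_eq, Finset.mem_univ, if_true, Finset.sum_mul]

/-- If a weighted sum of differences vanishes at a maximum of `x`, then every in-neighbour
of that maximum attains the same value. -/
lemma eq_of_sum_mul_sub_eq_zero {ι : Type*} [Fintype ι] {w x : ι → ℝ} (hw : ∀ j, 0 ≤ w j)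
    {i : ι} (hmax : ∀ j, x j ≤ x i) (hsum : ∑ j, w j * (x i - x j) = 0)
    {j : ι} (hj : 0 < w j) : x j = x i := by
  have hzero := (Finset.sum_eq_zero_iff_of_nonneg
    fun k _ => mul_nonneg (hw k) (sub_nonneg.2 (hmax k))).1 hsum j (Finset.mem_univ j)
  exact (sub_eq_zero.1 ((mul_eq_zero.1 hzero).resolve_left hj.ne')).symm

/-- The kernel of the Laplacian of a strongly connected weighted
digraph is exactly the span of the all-ones vector: `L x = 0` iff `x` is constant. -/
theorem laplacian_kernel_eq_span_ones
    (N : ℕ) (hN : 2 ≤ N) (a : Fin N → Fin N → ℝ)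
    (ha_nonneg : ∀ i j, 0 ≤ a i j) (ha_diag : ∀ i, a i i = 0)
    (hconn : ∀ i j : Fin N, i ≠ j →
      Relation.TransGen (fun p q : Fin N => 0 < a q p) i j)
    (L : Matrix (Fin N) (Fin N) ℝ)
    (hL : ∀ i j, L i j = if i = j then ∑ k, a i k else -(a i j)) :
    ∀ x : Fin N → ℝ, L.mulVec x = 0 ↔ ∃ c : ℝ, x = fun _ => c := by
  intro x
  constructor
  · intro hx
    have : Nonempty (Fin N) := ⟨⟨0, by omega⟩⟩
    obtain ⟨m, hm⟩ := Finite.exists_max x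
    refine ⟨x m, funext fun i => ?_⟩
    rcases eq_or_ne i m with rfl | him
    · rfl
    have hstep : ∀ p q : Fin N, 0 < a q p → x q = x m → x p = x m := by
      intro p q hpq hq
      have hsum : ∑ j, a q j * (x q - x j) = 0 := by
        rw [← laplacian_mulVec_apply ha_diag hL, hx, Pi.zero_apply]
      exact (eq_of_sum_mul_sub_eq_zero (ha_nonneg q) (fun j => hq ▸ hm j) hsum hpq).trans hq
    have hpath := hconn i m him
    clear him
    induction hpath using Relation.TransGen.head_induction_on with
    | single h => exact hstep _ _ h rfl
    | head h _ ih => exact hstep _ _ h ih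
  · rintro ⟨c, rfl⟩
    ext i
    simp [laplacian_mulVec_apply ha_diag hL]
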